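/- arXiv:1805.07708 — 9 statements merged into one kernel-verified Lean document; each statement's English description precedes it below -/
import Mathlib

section
/- Let X be a finite nonempty type and T̄ ≥ 0. Let M be an entrywise-nonnegative real square matrix indexed by X with row sums Σ_{x'} M(x,x') ≤ T̄ for all x, let Q be a real square matrix indexed by X and δ : X → ℝ with Σ_{x'} |Q(x,x')| ≤ 2 δ(x) for all x, and let u : X → ℝ with u(x) ≥ 0 and u(x) ≥ 2 T̄ δ(x) · max_{x'} u(x') for all x. Then u(x) + (Q (M u))(x) ≥ 0 for all x ∈ X. -/
/-- Key step of Theorem 1: `u + Q (M u) ≥ 0` pointwise. -/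
theorem stmt_5 {X : Type*} [Fintype X] [Nonempty X]
    (T : ℝ) (hT : 0 ≤ T)
    (M Q : Matrix X X ℝ) (hM : ∀ x x', 0 ≤ M x x')
    (hrow : ∀ x, ∑ x', M x x' ≤ T)
    (δ : X → ℝ) (hQ : ∀ x, ∑ x', |Q x x'| ≤ 2 * δ x)
    (u : X → ℝ) (hu : ∀ x, 0 ≤ u x)
    (hu2 : ∀ x, 2 * T * δ x * (Finset.univ.sup' Finset.univ_nonempty u) ≤ u x) :
    ∀ x, 0 ≤ u x + Q.mulVec (M.mulVec u) x := by
  intro x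
  have hle : ∀ y, u y ≤ Finset.univ.sup' Finset.univ_nonempty u :=
    fun y => Finset.le_sup' u (Finset.mem_univ y)
  have hx := hu2 x
  generalize Finset.univ.sup' Finset.univ_nonempty u = S at hle hx
  have hS : 0 ≤ S := (hu x).trans (hle x)
  have h0 : ∀ y, 0 ≤ M.mulVec u y := fun y =>
    Finset.sum_nonneg fun z _ => mul_nonneg (hM y z) (hu z)
  have h1 : ∀ y, M.mulVec u y ≤ T * S := fun y => by
    calc M.mulVec u y = ∑ z, M y z * u z := rfl
      _ ≤ ∑ z, M y z * S :=
        Finset.sum_le_sum fun z _ => mul_le_mul_of_nonneg_left (hle z) (hM y z)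
      _ = (∑ z, M y z) * S := by rw [Finset.sum_mul]
      _ ≤ T * S := mul_le_mul_of_nonneg_right (hrow y) hS
  have h2 : -(2 * δ x * (T * S)) ≤ Q.mulVec (M.mulVec u) x := by
    calc -(2 * δ x * (T * S)) ≤ -((∑ y, |Q x y|) * (T * S)) :=
          neg_le_neg (mul_le_mul_of_nonneg_right (hQ x) (mul_nonneg hT hS))
      _ = ∑ y, -(|Q x y| * (T * S)) := by rw [Finset.sum_mul, Finset.sum_neg_distrib]
      _ ≤ ∑ y, Q x y * M.mulVec u y := by
        refine Finset.sum_le_sum fun y _ => ?_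
        have a := mul_le_mul_of_nonneg_left (h1 y) (abs_nonneg (Q x y))
        have b := mul_le_mul_of_nonneg_right (neg_abs_le (Q x y)) (h0 y)
        linarith
      _ = Q.mulVec (M.mulVec u) x := rfl
  linarith
end

section
/- Let X and A be finite nonempty types, x₀ ∈ X, and let P : X → A → X → ℝ be a substochastic kernel (P(x'|x,a) ≥ 0 and Σ_{x'} P(x'|x,a) ≤ 1). Let π⋆ and π_B be policies with induced transition matrices P⋆(x,x') = Σ_a π⋆(a|x) P(x'|x,a) and P_B(x,x') = Σ_a π_B(a|x) P(x'|x,a). Let d : X → ℝ with 0 ≤ d(x) ≤ D_max for all x, where D_max > 0, and let T̄ > 0, d₀ ∈ ℝ, and D̄ be reals with 0 ≤ D̄ ≤ T̄ · D_max. Assume: (i) I − P_B is invertible, M_B := (I − P_B)⁻¹ is entrywise nonnegative, and Σ_{x'} M_B(x,x') ≤ T̄ for all x; (ii) I − P⋆ is invertible, (I − P⋆)⁻¹ is entrywise nonnegative, and ((I − P⋆)⁻¹ d)(x) ≤ D̄ for all x; (iii) defining ε⋆(x) := 2 T̄ D_max · D_TV(π⋆‖π_B)(x), Assumption 1 holds: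 ε⋆(x) ≤ D_max · min{ (d₀ − (M_B d)(x₀)) / (T̄ D_max), (T̄ D_max − D̄) / (T̄ D_max + D̄) } for all x. Then the Lyapunov function candidate L := M_B (d + ε⋆) satisfies: d(x) + (P⋆ L)(x) ≤ L(x) for all x ∈ X, and L(x₀) ≤ d₀. -/
/-- Theorem 1 of the paper: Under Assumption 1, the candidate
`L = (I − P_B)⁻¹ (d + ε⋆)` satisfies `d + P⋆ L ≤ L` pointwise and `L x₀ ≤ d₀`. -/
theorem stmt_6 {X A : Type*} [Fintype X] [Fintype A] [Nonempty X] [Nonempty A] [DecidableEq X]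
    (x₀ : X) (P : X → A → X → ℝ)
    (hPnn : ∀ x a x', 0 ≤ P x a x') (hPsub : ∀ x a, ∑ x', P x a x' ≤ 1)
    (πs πB : X → A → ℝ)
    (hπs : ∀ x a, 0 ≤ πs x a) (hπs1 : ∀ x, ∑ a, πs x a = 1)
    (hπB : ∀ x a, 0 ≤ πB x a) (hπB1 : ∀ x, ∑ a, πB x a = 1)
    (d : X → ℝ) (Dmax T d₀ D' : ℝ)
    (hd : ∀ x, 0 ≤ d x ∧ d x ≤ Dmax) (hDmax : 0 < Dmax)
    (hT : 0 < T) (hD' : 0 ≤ D' ∧ D' ≤ T * Dmax)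
    (Ps PBmat : Matrix X X ℝ)
    (hPsdef : Ps = Matrix.of fun x x' => ∑ a, πs x a * P x a x')
    (hPBdef : PBmat = Matrix.of fun x x' => ∑ a, πB x a * P x a x')
    (hBinv : IsUnit (1 - PBmat))
    (hMBnn : ∀ x x', 0 ≤ (1 - PBmat)⁻¹ x x')
    (hMBrow : ∀ x, ∑ x', (1 - PBmat)⁻¹ x x' ≤ T)
    (hsinv : IsUnit (1 - Ps))
    (hMsnn : ∀ x x', 0 ≤ (1 - Ps)⁻¹ x x')
    (hDs : ∀ x, (1 - Ps)⁻¹.mulVec d x ≤ D')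
    (εs : X → ℝ)
    (hεdef : εs = fun x => 2 * T * Dmax * ((1 / 2) * ∑ a, |πs x a - πB x a|))
    (hA1 : ∀ x, εs x ≤ Dmax * min ((d₀ - (1 - PBmat)⁻¹.mulVec d x₀) / (T * Dmax))
        ((T * Dmax - D') / (T * Dmax + D'))) :
    (∀ x, d x + Ps.mulVec ((1 - PBmat)⁻¹.mulVec (d + εs)) x ≤
        (1 - PBmat)⁻¹.mulVec (d + εs) x) ∧
      (1 - PBmat)⁻¹.mulVec (d + εs) x₀ ≤ d₀ := by
  have hε0 : ∀ x, 0 ≤ εs x := by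
    intro x
    rw [hεdef]
    have : 0 ≤ ∑ a, |πs x a - πB x a| := Finset.sum_nonneg fun a _ => abs_nonneg _
    positivity
  have hK : 0 < T * Dmax := mul_pos hT hDmax
  have hε1 : ∀ x, εs x ≤ Dmax := by
    intro x
    have h1 : (T * Dmax - D') / (T * Dmax + D') ≤ 1 := by
      rw [div_le_one (by linarith [hD'.1])]
      linarith [hD'.1]
    calc εs x ≤ _ := hA1 x
      _ ≤ Dmax * 1 := mul_le_mul_of_nonneg_left ((min_le_right _ _).trans h1) hDmax.le
      _ = Dmax := mul_one _
  have hε2 : ∀ x, εs x ≤ (d₀ - (1 - PBmat)⁻¹.mulVec d x₀) / T := by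
    intro x
    calc εs x ≤ _ := hA1 x
      _ ≤ Dmax * ((d₀ - (1 - PBmat)⁻¹.mulVec d x₀) / (T * Dmax)) :=
        mul_le_mul_of_nonneg_left (min_le_left _ _) hDmax.le
      _ = _ := by field_simp
  -- rows of `M_B` against a bounded function
  have hrow : ∀ (f : X → ℝ) (c : ℝ), 0 ≤ c → (∀ x, f x ≤ c) →
      ∀ x, (1 - PBmat)⁻¹.mulVec f x ≤ T * c := by
    intro f c hc hf x
    calc (1 - PBmat)⁻¹.mulVec f x = ∑ y, (1 - PBmat)⁻¹ x y * f y := rfl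
      _ ≤ ∑ y, (1 - PBmat)⁻¹ x y * c :=
        Finset.sum_le_sum fun y _ => mul_le_mul_of_nonneg_left (hf y) (hMBnn x y)
      _ = (∑ y, (1 - PBmat)⁻¹ x y) * c := by rw [Finset.sum_mul]
      _ ≤ T * c := mul_le_mul_of_nonneg_right (hMBrow x) hc
  constructor
  · intro x
    set L := (1 - PBmat)⁻¹.mulVec (d + εs) with hL
    have hL0 : ∀ y, 0 ≤ L y := fun y =>
      Finset.sum_nonneg fun z _ => mul_nonneg (hMBnn y z) (add_nonneg (hd z).1 (hε0 z))
    have hL1 : ∀ y, L y ≤ 2 * (T * Dmax) := by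
      intro y
      have := hrow (d + εs) (2 * Dmax) (by linarith)
        (fun z => by simp only [Pi.add_apply]; linarith [(hd z).2, hε1 z]) y
      linarith
    have hfix : L x - PBmat.mulVec L x = d x + εs x := by
      have h : (1 - PBmat).mulVec L = d + εs := by
        rw [hL, Matrix.mulVec_mulVec,
          Matrix.mul_nonsing_inv _ ((Matrix.isUnit_iff_isUnit_det _).1 hBinv), Matrix.one_mulVec]
      have h2 := congrFun h x
      rwa [Matrix.sub_mulVec, Matrix.one_mulVec] at h2
    have hexp : ∀ (π : X → A → ℝ),
        (Matrix.of fun x x' => ∑ a, π x a * P x a x').mulVec L x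
          = ∑ a, π x a * ∑ y, P x a y * L y := by
      intro π
      simp only [Matrix.mulVec, dotProduct, Matrix.of_apply, Finset.sum_mul, Finset.mul_sum]
      rw [Finset.sum_comm]
      simp only [mul_assoc]
    have hq0 : ∀ a, 0 ≤ ∑ y, P x a y * L y := fun a =>
      Finset.sum_nonneg fun y _ => mul_nonneg (hPnn x a y) (hL0 y)
    have hq1 : ∀ a, ∑ y, P x a y * L y ≤ 2 * (T * Dmax) := by
      intro a
      calc ∑ y, P x a y * L y ≤ ∑ y, P x a y * (2 * (T * Dmax)) :=
            Finset.sum_le_sum fun y _ => mul_le_mul_of_nonneg_left (hL1 y) (hPnn x a y)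
        _ = (∑ y, P x a y) * (2 * (T * Dmax)) := by rw [Finset.sum_mul]
        _ ≤ 1 * (2 * (T * Dmax)) := mul_le_mul_of_nonneg_right (hPsub x a) (by linarith)
        _ = _ := one_mul _
    have hdiff : Ps.mulVec L x - PBmat.mulVec L x ≤ εs x := by
      rw [hPsdef, hexp]
      nth_rewrite 1 [hPBdef]
      rw [hexp]
      have hz : ∑ a, (πs x a - πB x a) * (T * Dmax) = 0 := by
        rw [← Finset.sum_mul, Finset.sum_sub_distrib, hπs1, hπB1]; ring
      calc ∑ a, πs x a * ∑ y, P x a y * L y - ∑ a, πB x a * ∑ y, P x a y * L y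
          = ∑ a, (πs x a - πB x a) * (∑ y, P x a y * L y - T * Dmax)
              + ∑ a, (πs x a - πB x a) * (T * Dmax) := by
            rw [← Finset.sum_sub_distrib, ← Finset.sum_add_distrib]
            exact Finset.sum_congr rfl fun a _ => by ring
        _ = ∑ a, (πs x a - πB x a) * (∑ y, P x a y * L y - T * Dmax) := by rw [hz, add_zero]
        _ ≤ ∑ a, |πs x a - πB x a| * (T * Dmax) := by
            refine Finset.sum_le_sum fun a _ => ?_
            refine (le_abs_self _).trans ?_
            rw [abs_mul]
            refine mul_le_mul_of_nonneg_left ?_ (abs_nonneg _)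
            rw [abs_le]
            constructor <;> linarith [hq0 a, hq1 a]
        _ = εs x := by rw [hεdef, ← Finset.sum_mul]; ring
    linarith
  · have hc : 0 ≤ (d₀ - (1 - PBmat)⁻¹.mulVec d x₀) / T := (hε0 x₀).trans (hε2 x₀)
    have h := hrow εs _ hc hε2 x₀
    rw [mul_div_cancel₀ _ hT.ne'] at h
    rw [Matrix.mulVec_add, Pi.add_apply]
    linarith
end

section
/- Let X be a finite nonempty type, x₀ ∈ X, and d₀ ∈ ℝ. Let P be an entrywise-nonnegative real square matrix indexed by X such that I − P is invertible and (I − P)⁻¹ is entrywise nonnegative. Let d, L : X → ℝ satisfy d(x) + (P L)(x) ≤ L(x) for all x and L(x₀) ≤ d₀. Then ((I − P)⁻¹ d)(x₀) ≤ d₀. -/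
/-- Any L-induced policy is feasible: if `d + P L ≤ L` pointwise and
`L x₀ ≤ d₀`, then `((I − P)⁻¹ d) x₀ ≤ d₀`. -/
theorem stmt_7 {X : Type*} [Fintype X] [Nonempty X] [DecidableEq X]
    (x₀ : X) (d₀ : ℝ)
    (P : Matrix X X ℝ) (hPnn : ∀ x x', 0 ≤ P x x')
    (hInv : IsUnit (1 - P)) (hMnn : ∀ x x', 0 ≤ (1 - P)⁻¹ x x')
    (d L : X → ℝ)
    (hLyap : ∀ x, d x + P.mulVec L x ≤ L x) (hL0 : L x₀ ≤ d₀) :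
    (1 - P)⁻¹.mulVec d x₀ ≤ d₀ := by
  have h1 : (1 - P)⁻¹.mulVec ((1 - P).mulVec L) = L := by
    rw [Matrix.mulVec_mulVec, Matrix.nonsing_inv_mul _ ((Matrix.isUnit_iff_isUnit_det _).mp hInv),
      Matrix.one_mulVec]
  have h2 : (1 - P)⁻¹.mulVec d x₀ ≤ (1 - P)⁻¹.mulVec ((1 - P).mulVec L) x₀ := by
    refine Finset.sum_le_sum fun x _ => mul_le_mul_of_nonneg_left ?_ (hMnn x₀ x)
    rw [Matrix.sub_mulVec, Matrix.one_mulVec, Pi.sub_apply]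
    linarith [hLyap x]
  rw [h1] at h2
  exact h2.trans hL0
end

section
/- Let X be a finite nonempty type. Let P₀ and P₁ be real square matrices indexed by X such that I − P₀ and I − P₁ are invertible and both (I − P₀)⁻¹ and (I − P₁)⁻¹ are entrywise nonnegative, and let c₀, c₁ : X → ℝ. Let V₀ := (I − P₀)⁻¹ c₀. If c₁(x) + (P₁ V₀)(x) ≤ V₀(x) for all x ∈ X, then ((I − P₁)⁻¹ c₁)(x) ≤ V₀(x) for all x ∈ X. -/
/-- Monotonic policy improvement: if `c₁ + P₁ V₀ ≤ V₀` pointwise for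
`V₀ = (I − P₀)⁻¹ c₀`, then `(I − P₁)⁻¹ c₁ ≤ V₀` pointwise. -/
theorem stmt_8 {X : Type*} [Fintype X] [Nonempty X] [DecidableEq X]
    (P₀ P₁ : Matrix X X ℝ) (h₀ : IsUnit (1 - P₀)) (h₁ : IsUnit (1 - P₁))
    (hM₀ : ∀ x x', 0 ≤ (1 - P₀)⁻¹ x x') (hM₁ : ∀ x x', 0 ≤ (1 - P₁)⁻¹ x x')
    (c₀ c₁ : X → ℝ)
    (himp : ∀ x, c₁ x + P₁.mulVec ((1 - P₀)⁻¹.mulVec c₀) x ≤ (1 - P₀)⁻¹.mulVec c₀ x) :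
    ∀ x, (1 - P₁)⁻¹.mulVec c₁ x ≤ (1 - P₀)⁻¹.mulVec c₀ x := by
  intro x
  generalize (1 - P₀)⁻¹.mulVec c₀ = V at himp ⊢
  have hV : (1 - P₁)⁻¹.mulVec ((1 - P₁).mulVec V) = V := by
    rw [Matrix.mulVec_mulVec, Matrix.nonsing_inv_mul _ ((Matrix.isUnit_iff_isUnit_det _).mp h₁),
      Matrix.one_mulVec]
  have hx : (1 - P₁)⁻¹.mulVec c₁ x ≤ (1 - P₁)⁻¹.mulVec ((1 - P₁).mulVec V) x := by
    refine Finset.sum_le_sum fun y _ => mul_le_mul_of_nonneg_left ?_ (hM₁ x y)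
    rw [Matrix.sub_mulVec, Matrix.one_mulVec, Pi.sub_apply]
    linarith [himp y]
  rwa [hV] at hx
end

section
/- Let X and A be finite nonempty types, let P : X → A → X → ℝ satisfy P(x'|x,a) ≥ 0, let c : X → A → ℝ, and for each x ∈ X let F(x) be a nonempty set of probability vectors on A. Define T[V](x) := inf_{p ∈ F(x)} Σ_a p(a) ( c(x,a) + Σ_{x'} P(x'|x,a) V(x') ). Suppose there exist ρ : X → ℝ with ρ(x) > 0 for all x and γ ∈ [0,1) such that for every x and every p ∈ F(x): Σ_a p(a) Σ_{x'} P(x'|x,a) ρ(x') ≤ γ ρ(x). Then for all V, W : X → ℝ: max_x |T[V](x) − T[W](x)| / ρ(x) ≤ γ · max_x |V(x) − W(x)| / ρ(x); that is, T is a γ-contraction in the ρ-weighted sup norm ‖V‖_ρ = max_x |V(x)|/ρ(x). -/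
/-- The safe Bellman operator is a `γ`-contraction in the
`ρ`-weighted sup norm. -/
theorem stmt_11 {X A : Type*} [Fintype X] [Fintype A] [Nonempty X] [Nonempty A]
    (P : X → A → X → ℝ) (hPnn : ∀ x a x', 0 ≤ P x a x')
    (c : X → A → ℝ)
    (F : X → Set (A → ℝ)) (hFne : ∀ x, (F x).Nonempty)
    (hF : ∀ x, ∀ p ∈ F x, (∀ a, 0 ≤ p a) ∧ ∑ a, p a = 1)
    (T : (X → ℝ) → X → ℝ)
    (hT : ∀ V x, T V x = ⨅ p : F x, ∑ a, p.1 a * (c x a + ∑ x', P x a x' * V x'))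
    (ρ : X → ℝ) (hρ : ∀ x, 0 < ρ x)
    (γ : ℝ) (hγ0 : 0 ≤ γ) (hγ1 : γ < 1)
    (hcontr : ∀ x, ∀ p ∈ F x, ∑ a, p a * ∑ x', P x a x' * ρ x' ≤ γ * ρ x) :
    ∀ V W : X → ℝ,
      Finset.univ.sup' Finset.univ_nonempty (fun x => |T V x - T W x| / ρ x) ≤
        γ * Finset.univ.sup' Finset.univ_nonempty (fun x => |V x - W x| / ρ x) := by
  have key : ∀ (V W : X → ℝ) (M : ℝ), 0 ≤ M → (∀ y, V y ≤ W y + M * ρ y) →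
      ∀ x, T V x ≤ T W x + γ * M * ρ x := by
    intro V W M hM hVW x
    haveI : Nonempty (F x) := (hFne x).to_subtype
    have hbdd : BddBelow (Set.range fun p : F x =>
        ∑ a, p.1 a * (c x a + ∑ x', P x a x' * V x')) := by
      refine ⟨-∑ a, |c x a + ∑ x', P x a x' * V x'|, ?_⟩
      rintro _ ⟨p, rfl⟩
      obtain ⟨h0, h1⟩ := hF x p.1 p.2
      rw [← Finset.sum_neg_distrib]
      refine Finset.sum_le_sum fun a _ => ?_
      have hp1 : p.1 a ≤ 1 := by
        rw [← h1]
        exact Finset.single_le_sum (fun b _ => h0 b) (Finset.mem_univ a)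
      have h2 := neg_abs_le (c x a + ∑ x', P x a x' * V x')
      have h3 := abs_nonneg (c x a + ∑ x', P x a x' * V x')
      nlinarith [h0 a, mul_nonneg (sub_nonneg.2 hp1) h3,
        mul_le_mul_of_nonneg_left h2 (h0 a)]
    rw [← sub_le_iff_le_add, hT W x]
    refine le_ciInf fun p => ?_
    rw [sub_le_iff_le_add, hT V x]
    refine (ciInf_le hbdd p).trans ?_
    obtain ⟨h0, -⟩ := hF x p.1 p.2
    have hc := mul_le_mul_of_nonneg_left (hcontr x p.1 p.2) hM
    have hstep : ∑ a, p.1 a * (c x a + ∑ x', P x a x' * V x') ≤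
        ∑ a, (p.1 a * (c x a + ∑ x', P x a x' * W x') +
          M * (p.1 a * ∑ x', P x a x' * ρ x')) := by
      refine Finset.sum_le_sum fun a _ => ?_
      have hin : ∑ x', P x a x' * V x' ≤
          ∑ x', P x a x' * W x' + M * ∑ x', P x a x' * ρ x' := by
        rw [Finset.mul_sum, ← Finset.sum_add_distrib]
        refine Finset.sum_le_sum fun y _ => ?_
        have := mul_le_mul_of_nonneg_left (hVW y) (hPnn x a y)
        linarith
      have := mul_le_mul_of_nonneg_left hin (h0 a)
      linarith
    rw [Finset.sum_add_distrib, ← Finset.mul_sum] at hstep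
    linarith
  intro V W
  set M := Finset.univ.sup' Finset.univ_nonempty (fun x => |V x - W x| / ρ x) with hMdef
  have hMx : ∀ y, |V y - W y| ≤ M * ρ y := fun y => by
    rw [← div_le_iff₀ (hρ y)]
    exact Finset.le_sup' (fun x => |V x - W x| / ρ x) (Finset.mem_univ y)
  have hM : 0 ≤ M := by
    obtain ⟨y⟩ := ‹Nonempty X›
    exact (div_nonneg (abs_nonneg (V y - W y)) (hρ y).le).trans
      (Finset.le_sup' (fun x => |V x - W x| / ρ x) (Finset.mem_univ y))
  refine Finset.sup'_le _ _ fun x _ => ?_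
  rw [div_le_iff₀ (hρ x), abs_le]
  have h1 := key V W M hM (fun y => by linarith [(abs_le.1 (hMx y)).2]) x
  have h2 := key W V M hM (fun y => by linarith [(abs_le.1 (hMx y)).1]) x
  constructor <;> linarith
end

section
/- Let X and A be finite nonempty types, x₀ ∈ X, P : X → A → X → ℝ a substochastic kernel (P(x'|x,a) ≥ 0, Σ_{x'} P(x'|x,a) ≤ 1), c : X → A → ℝ with c ≥ 0, d : X → ℝ with 0 ≤ d(x) ≤ D_max where D_max > 0, and reals d₀ ≥ 0, T̄ > 0, and D̄ with 0 ≤ D̄ ≤ T̄ D_max. A policy is π : X → A → ℝ with π(a|x) ≥ 0 and Σ_a π(a|x) = 1, with transition matrix P_π(x,x') = Σ_a π(a|x) P(x'|x,a) and cost vector c_π(x) = Σ_a π(a|x) c(x,a). Assume that for every policy π: I − P_π is invertible, M_π := (I − P_π)⁻¹ is entrywise nonnegative with row sums ≤ T̄, and (M_π d)(x) ≤ D̄ for all x. Define C_π := M_π c_π and D_π := M_π d, and call π feasible if D_π(x₀) ≤ d₀. Let π⋆ be a feasible policy with C_{π⋆}(x₀) ≤ C_π(x₀) for every feasible π (an optimal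 policy of problem OPT), let π_B be a feasible policy, let ε⋆(x) := 2 T̄ D_max · (1/2) Σ_a |π⋆(a|x) − π_B(a|x)|, and assume Assumption 1: ε⋆(x) ≤ D_max · min{ (d₀ − D_{π_B}(x₀)) / (T̄ D_max), (T̄ D_max − D̄) / (T̄ D_max + D̄) } for all x. Set L := M_{π_B}(d + ε⋆) and, for each x, F_L(x) := { probability vectors p on A : Σ_a p(a) ( d(x) + Σ_{x'} P(x'|x,a) L(x') ) ≤ L(x) }. If V⋆ : X → ℝ satisfies the safe Bellman fixed-point equation V⋆(x) = inf_{p ∈ F_L(x)} Σ_a p(a) ( c(x,a) + Σ_{x'} P(x'|x,a) V⋆(x') ) for every x ∈ X, then V⋆(x₀) = C_{π⋆}(x₀), the optimal value of problem OPT. -/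
/-- A Markov stationary policy: nonnegative action probabilities summing to one. -/
def IsPolicy {X A : Type*} [Fintype A] (π : X → A → ℝ) : Prop :=
  (∀ x a, 0 ≤ π x a) ∧ ∀ x, ∑ a, π x a = 1

/-- Transition matrix induced by a policy. -/
def polMat {X A : Type*} [Fintype A] (P : X → A → X → ℝ) (π : X → A → ℝ) :
    Matrix X X ℝ :=
  Matrix.of fun x x' => ∑ a, π x a * P x a x'

/-- Immediate cost vector induced by a policy. -/
def polCost {X A : Type*} [Fintype A] (c : X → A → ℝ) (π : X → A → ℝ) : X → ℝ :=
  fun x => ∑ a, π x a * c x a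

theorem aux_le {X : Type*} [Fintype X] [DecidableEq X] (Q : Matrix X X ℝ)
    (hu : IsUnit (1 - Q)) (hn : ∀ x x', 0 ≤ (1 - Q)⁻¹ x x') (v b : X → ℝ)
    (h : ∀ x, v x ≤ b x + Q.mulVec v x) (x : X) : v x ≤ (1 - Q)⁻¹.mulVec b x := by
  have hdet : IsUnit (1 - Q).det := (Matrix.isUnit_iff_isUnit_det _).1 hu
  have e : (1 - Q)⁻¹.mulVec ((1 - Q).mulVec v) = v := by
    rw [Matrix.mulVec_mulVec, Matrix.nonsing_inv_mul _ hdet, Matrix.one_mulVec]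
  calc v x = (1 - Q)⁻¹.mulVec ((1 - Q).mulVec v) x := by rw [e]
    _ ≤ _ := by
      apply Finset.sum_le_sum
      intro y _
      apply mul_le_mul_of_nonneg_left _ (hn x y)
      rw [Matrix.sub_mulVec, Matrix.one_mulVec]
      have := h y
      simp only [Pi.sub_apply]
      linarith

theorem aux_ge {X : Type*} [Fintype X] [DecidableEq X] (Q : Matrix X X ℝ)
    (hu : IsUnit (1 - Q)) (hn : ∀ x x', 0 ≤ (1 - Q)⁻¹ x x') (v b : X → ℝ)
    (h : ∀ x, b x + Q.mulVec v x ≤ v x) (x : X) : (1 - Q)⁻¹.mulVec b x ≤ v x := by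
  have := aux_le Q hu hn (-v) (-b) (fun y => by
    rw [Matrix.mulVec_neg]
    have := h y
    simp only [Pi.neg_apply]
    linarith) x
  rw [Matrix.mulVec_neg] at this
  simpa using this

theorem aux_fix {X : Type*} [Fintype X] [DecidableEq X] (Q : Matrix X X ℝ)
    (hu : IsUnit (1 - Q)) (b : X → ℝ) (x : X) :
    (1 - Q)⁻¹.mulVec b x = b x + Q.mulVec ((1 - Q)⁻¹.mulVec b) x := by
  have hdet : IsUnit (1 - Q).det := (Matrix.isUnit_iff_isUnit_det _).1 hu
  have e : (1 - Q).mulVec ((1 - Q)⁻¹.mulVec b) = b := by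
    rw [Matrix.mulVec_mulVec, Matrix.mul_nonsing_inv _ hdet, Matrix.one_mulVec]
  rw [Matrix.sub_mulVec, Matrix.one_mulVec] at e
  have := congrFun e x
  simp only [Pi.sub_apply] at this
  linarith

theorem aux_mulVec_le {X : Type*} [Fintype X] (N : Matrix X X ℝ) (hn : ∀ x x', 0 ≤ N x x')
    (T K : ℝ) (hK : 0 ≤ K) (hr : ∀ x, ∑ x', N x x' ≤ T) (b : X → ℝ) (hb : ∀ x, b x ≤ K) (x : X) :
    N.mulVec b x ≤ T * K := by
  calc N.mulVec b x ≤ ∑ y, N x y * K :=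
        Finset.sum_le_sum fun y _ => mul_le_mul_of_nonneg_left (hb y) (hn x y)
    _ = (∑ y, N x y) * K := by rw [Finset.sum_mul]
    _ ≤ T * K := mul_le_mul_of_nonneg_right (hr x) hK

theorem aux_polMat {X A : Type*} [Fintype X] [Fintype A] (P : X → A → X → ℝ) (π : X → A → ℝ)
    (v : X → ℝ) (x : X) :
    (polMat P π).mulVec v x = ∑ a, π x a * ∑ x', P x a x' * v x' := by
  simp only [polMat, Matrix.mulVec, dotProduct, Matrix.of_apply, Finset.sum_mul, Finset.mul_sum]
  rw [Finset.sum_comm]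
  simp only [mul_assoc]

theorem aux_tv {A : Type*} [Fintype A] (p q g : A → ℝ) (K : ℝ)
    (hp : ∑ a, p a = 1) (hq : ∑ a, q a = 1) (h0 : ∀ a, 0 ≤ g a) (hK : ∀ a, g a ≤ K) :
    ∑ a, p a * g a - ∑ a, q a * g a ≤ K * ((1 / 2) * ∑ a, |p a - q a|) := by
  have h1 : ∑ a, p a * g a - ∑ a, q a * g a
      ≤ ∑ a, ((K / 2) * |p a - q a| + (K / 2) * p a - (K / 2) * q a) := by
    rw [← Finset.sum_sub_distrib]
    apply Finset.sum_le_sum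
    intro a _
    have := h0 a
    have := hK a
    rcases abs_cases (p a - q a) with ⟨e, h⟩ | ⟨e, h⟩ <;> rw [e] <;> nlinarith
  rw [Finset.sum_sub_distrib, Finset.sum_add_distrib, ← Finset.mul_sum, ← Finset.mul_sum,
    ← Finset.mul_sum, hp, hq] at h1
  linarith

/-- Theorem 2 of the paper: under Assumption 1, the fixed point of the
safe Bellman operator at `x₀` equals the optimal value of problem OPT. -/
theorem stmt_13 {X A : Type*} [Fintype X] [Fintype A] [Nonempty X] [Nonempty A]
    [DecidableEq X]
    (x₀ : X) (P : X → A → X → ℝ)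
    (hPnn : ∀ x a x', 0 ≤ P x a x') (hPsub : ∀ x a, ∑ x', P x a x' ≤ 1)
    (c : X → A → ℝ) (hc : ∀ x a, 0 ≤ c x a)
    (d : X → ℝ) (Dmax d₀ T D' : ℝ)
    (hd : ∀ x, 0 ≤ d x ∧ d x ≤ Dmax) (hDmax : 0 < Dmax)
    (hd₀ : 0 ≤ d₀) (hT : 0 < T) (hD' : 0 ≤ D' ∧ D' ≤ T * Dmax)
    (hInv : ∀ π : X → A → ℝ, IsPolicy π → IsUnit (1 - polMat P π))
    (hMnn : ∀ π : X → A → ℝ, IsPolicy π → ∀ x x', 0 ≤ (1 - polMat P π)⁻¹ x x')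
    (hMrow : ∀ π : X → A → ℝ, IsPolicy π → ∀ x, ∑ x', (1 - polMat P π)⁻¹ x x' ≤ T)
    (hDb : ∀ π : X → A → ℝ, IsPolicy π → ∀ x, (1 - polMat P π)⁻¹.mulVec d x ≤ D')
    (πs : X → A → ℝ) (hπs : IsPolicy πs)
    (hπsFeas : (1 - polMat P πs)⁻¹.mulVec d x₀ ≤ d₀)
    (hπsOpt : ∀ π : X → A → ℝ, IsPolicy π → (1 - polMat P π)⁻¹.mulVec d x₀ ≤ d₀ →
      (1 - polMat P πs)⁻¹.mulVec (polCost c πs) x₀ ≤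
        (1 - polMat P π)⁻¹.mulVec (polCost c π) x₀)
    (πB : X → A → ℝ) (hπB : IsPolicy πB)
    (hπBFeas : (1 - polMat P πB)⁻¹.mulVec d x₀ ≤ d₀)
    (εs : X → ℝ)
    (hεdef : εs = fun x => 2 * T * Dmax * ((1 / 2) * ∑ a, |πs x a - πB x a|))
    (hA1 : ∀ x, εs x ≤ Dmax * min ((d₀ - (1 - polMat P πB)⁻¹.mulVec d x₀) / (T * Dmax))
        ((T * Dmax - D') / (T * Dmax + D')))
    (L : X → ℝ) (hL : L = (1 - polMat P πB)⁻¹.mulVec (d + εs))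
    (FL : X → Set (A → ℝ))
    (hFL : ∀ x, FL x = {p : A → ℝ | (∀ a, 0 ≤ p a) ∧ ∑ a, p a = 1 ∧
        ∑ a, p a * (d x + ∑ x', P x a x' * L x') ≤ L x})
    (Vs : X → ℝ)
    (hVs : ∀ x, Vs x = ⨅ p : FL x, ∑ a, p.1 a * (c x a + ∑ x', P x a x' * Vs x')) :
    Vs x₀ = (1 - polMat P πs)⁻¹.mulVec (polCost c πs) x₀ := by
  have hTD : 0 < T * Dmax := mul_pos hT hDmax
  have hε0 : ∀ x, 0 ≤ εs x := by
    intro x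
    rw [hεdef]
    have : 0 ≤ ∑ a, |πs x a - πB x a| := Finset.sum_nonneg fun a _ => abs_nonneg _
    have h2 : 0 ≤ 2 * T * Dmax := by linarith
    exact mul_nonneg h2 (by linarith)
  have hε1 : ∀ x, εs x ≤ Dmax := by
    intro x
    refine (hA1 x).trans ?_
    have h1 : (T * Dmax - D') / (T * Dmax + D') ≤ 1 := by
      rw [div_le_one (by linarith [hD'.1])]
      linarith [hD'.1]
    have := (min_le_right ((d₀ - (1 - polMat P πB)⁻¹.mulVec d x₀) / (T * Dmax)) _).trans h1
    nlinarith
  have hε2 : ∀ x, εs x ≤ (d₀ - (1 - polMat P πB)⁻¹.mulVec d x₀) / T := by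
    intro x
    refine (hA1 x).trans ?_
    refine (mul_le_mul_of_nonneg_left (min_le_left _ _) hDmax.le).trans (le_of_eq ?_)
    field_simp
  have hLx : ∀ x, L x = (1 - polMat P πB)⁻¹.mulVec d x + (1 - polMat P πB)⁻¹.mulVec εs x := by
    intro x
    rw [hL, Matrix.mulVec_add, Pi.add_apply]
  have hL0 : ∀ x, 0 ≤ L x := by
    intro x
    rw [hL]
    exact Finset.sum_nonneg fun y _ => mul_nonneg (hMnn πB hπB x y)
      (add_nonneg (hd y).1 (hε0 y))
  have hL1 : ∀ x, L x ≤ 2 * T * Dmax := by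
    intro x
    have h1 := hDb πB hπB x
    have h2 := aux_mulVec_le _ (hMnn πB hπB) T Dmax hDmax.le (hMrow πB hπB) εs hε1 x
    rw [hLx]
    linarith [hD'.2]
  have hLx0 : L x₀ ≤ d₀ := by
    have h2 := aux_mulVec_le _ (hMnn πB hπB) T _
      (div_nonneg (sub_nonneg.2 hπBFeas) hT.le) (hMrow πB hπB) εs hε2 x₀
    rw [mul_div_cancel₀ _ hT.ne'] at h2
    rw [hLx]
    linarith
  have hg : ∀ x a, 0 ≤ ∑ x', P x a x' * L x' := fun x a =>
    Finset.sum_nonneg fun y _ => mul_nonneg (hPnn x a y) (hL0 y)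
  have hg1 : ∀ x a, ∑ x', P x a x' * L x' ≤ 2 * T * Dmax := by
    intro x a
    calc ∑ x', P x a x' * L x' ≤ ∑ x', P x a x' * (2 * T * Dmax) :=
          Finset.sum_le_sum fun y _ => mul_le_mul_of_nonneg_left (hL1 y) (hPnn x a y)
      _ = (∑ x', P x a x') * (2 * T * Dmax) := by rw [Finset.sum_mul]
      _ ≤ 1 * (2 * T * Dmax) := mul_le_mul_of_nonneg_right (hPsub x a) (by linarith)
      _ = _ := one_mul _
  have hsplit : ∀ (p : A → ℝ) (k : ℝ) (g : A → ℝ), ∑ a, p a = 1 →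
      ∑ a, p a * (k + g a) = k + ∑ a, p a * g a := by
    intro p k g hp
    simp only [mul_add, Finset.sum_add_distrib]
    rw [← Finset.sum_mul, hp, one_mul]
  have hsmem : ∀ x, πs x ∈ FL x := by
    intro x
    rw [hFL]
    refine ⟨hπs.1 x, hπs.2 x, ?_⟩
    rw [hsplit _ _ _ (hπs.2 x)]
    have h1 := aux_tv (πs x) (πB x) (fun a => ∑ x', P x a x' * L x') (2 * T * Dmax)
      (hπs.2 x) (hπB.2 x) (hg x) (hg1 x)
    have h2 := aux_fix _ (hInv πB hπB) (d + εs) x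
    rw [← hL, aux_polMat, Pi.add_apply] at h2
    have h3 : εs x = 2 * T * Dmax * ((1 / 2) * ∑ a, |πs x a - πB x a|) := by rw [hεdef]
    rw [← h3] at h1
    linarith
  have hcompact : ∀ x, IsCompact (FL x) := by
    intro x
    have he : FL x = stdSimplex ℝ A ∩
        {p : A → ℝ | ∑ a, p a * (d x + ∑ x', P x a x' * L x') ≤ L x} := by
      rw [hFL]
      ext p
      simp [stdSimplex, and_assoc]
    rw [he]
    refine (isCompact_stdSimplex ℝ A).inter_right ?_
    exact isClosed_le (by fun_prop) continuous_const
  have hmin : ∀ x, ∃ p ∈ FL x, ∀ q ∈ FL x,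
      ∑ a, p a * (c x a + ∑ x', P x a x' * Vs x') ≤
        ∑ a, q a * (c x a + ∑ x', P x a x' * Vs x') := by
    intro x
    obtain ⟨p, hp, hq⟩ := (hcompact x).exists_isMinOn ⟨_, hsmem x⟩
      (f := fun p : A → ℝ => ∑ a, p a * (c x a + ∑ x', P x a x' * Vs x'))
      (Continuous.continuousOn (by fun_prop))
    exact ⟨p, hp, fun q hq' => hq hq'⟩
  choose π hπmem hπmin using hmin
  have hVeq : ∀ x, Vs x = ∑ a, π x a * (c x a + ∑ x', P x a x' * Vs x') := by
    intro x
    refine (hVs x).trans ?_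
    haveI : Nonempty (FL x) := ⟨⟨_, hsmem x⟩⟩
    apply le_antisymm
    · exact ciInf_le (f := fun p : FL x => ∑ a, p.1 a * (c x a + ∑ x', P x a x' * Vs x'))
        ⟨_, by rintro _ ⟨q, rfl⟩; exact hπmin x q.1 q.2⟩ ⟨π x, hπmem x⟩
    · exact le_ciInf fun q => hπmin x q.1 q.2
  have hsum : ∀ (ρ : X → A → ℝ) x, ∑ a, ρ x a * (c x a + ∑ x', P x a x' * Vs x') =
      polCost c ρ x + (polMat P ρ).mulVec Vs x := by
    intro ρ x
    rw [aux_polMat, polCost, ← Finset.sum_add_distrib]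
    simp only [mul_add]
  have hmem' : ∀ x, (∀ a, 0 ≤ π x a) ∧ ∑ a, π x a = 1 ∧
        ∑ a, π x a * (d x + ∑ x', P x a x' * L x') ≤ L x := by
    intro x
    have := hπmem x
    rw [hFL] at this
    exact this
  have hπ : IsPolicy π := ⟨fun x => (hmem' x).1, fun x => (hmem' x).2.1⟩
  apply le_antisymm
  · apply aux_le _ (hInv πs hπs) (hMnn πs hπs)
    intro x
    rw [← hsum, hVeq x]
    exact hπmin x _ (hsmem x)
  · refine (hπsOpt π hπ ?_).trans ?_
    · refine le_trans ?_ hLx0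
      apply aux_ge _ (hInv π hπ) (hMnn π hπ)
      intro x
      rw [aux_polMat, ← hsplit _ _ _ (hπ.2 x)]
      exact (hmem' x).2.2
    · apply aux_ge _ (hInv π hπ) (hMnn π hπ)
      intro x
      rw [← hsum, ← hVeq x]
end

section
/- Let X be a finite nonempty type, x₀ ∈ X, T̄ > 0 and d₀ ≥ 0 reals. Let P be an entrywise-nonnegative real square matrix indexed by X such that I − P is invertible and M := (I − P)⁻¹ is entrywise nonnegative with row sums Σ_{x'} M(x,x') ≤ T̄ for all x. Let d : X → ℝ satisfy d(x₀) ≤ 0 and the step-wise surrogate constraint (P d)(x) ≤ d₀ / T̄ for all x ∈ X. Then (M d)(x₀) ≤ d₀. -/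
/-- Feasibility of the step-wise surrogate: if `d x₀ ≤ 0` and
`(P d)(x) ≤ d₀ / T̄` everywhere, then `((I − P)⁻¹ d)(x₀) ≤ d₀`. -/
theorem stmt_15 {X : Type*} [Fintype X] [Nonempty X] [DecidableEq X]
    (x₀ : X) (T d₀ : ℝ) (hT : 0 < T) (hd₀ : 0 ≤ d₀)
    (P : Matrix X X ℝ) (hPnn : ∀ x x', 0 ≤ P x x')
    (hInv : IsUnit (1 - P)) (hMnn : ∀ x x', 0 ≤ (1 - P)⁻¹ x x')
    (hrow : ∀ x, ∑ x', (1 - P)⁻¹ x x' ≤ T)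
    (d : X → ℝ) (hdx₀ : d x₀ ≤ 0) (hstep : ∀ x, P.mulVec d x ≤ d₀ / T) :
    (1 - P)⁻¹.mulVec d x₀ ≤ d₀ := by
  have h1 : (1 - P)⁻¹ * (1 - P) = 1 :=
    Matrix.nonsing_inv_mul _ ((Matrix.isUnit_iff_isUnit_det _).1 hInv)
  have h2 : (1 - P)⁻¹ = 1 + (1 - P)⁻¹ * P := by
    rw [mul_sub, mul_one] at h1
    exact sub_eq_iff_eq_add.1 h1
  have h3 : (1 - P)⁻¹.mulVec d x₀ = d x₀ + (1 - P)⁻¹.mulVec (P.mulVec d) x₀ := by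
    conv_lhs => rw [h2]
    rw [Matrix.add_mulVec, Matrix.one_mulVec, Matrix.mulVec_mulVec, Pi.add_apply]
  have h4 : (1 - P)⁻¹.mulVec (P.mulVec d) x₀ ≤ ∑ x', (1 - P)⁻¹ x₀ x' * (d₀ / T) :=
    Finset.sum_le_sum fun x' _ => mul_le_mul_of_nonneg_left (hstep x') (hMnn x₀ x')
  rw [← Finset.sum_mul] at h4
  have h5 := mul_le_mul_of_nonneg_right (hrow x₀) (div_nonneg hd₀ hT.le)
  rw [mul_div_cancel₀ _ hT.ne'] at h5
  linarith
end

section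
/- Let X be a finite nonempty type, x ∈ X, and T̄ ≥ 0 a real. Let P and P' be real square matrices indexed by X such that I − P and I − P' are invertible, M := (I − P)⁻¹ and M' := (I − P')⁻¹ are entrywise nonnegative, and the row sums of M' satisfy Σ_y M'(w,y) ≤ T̄ for all w. Then Σ_y |M(x,y) − M'(x,y)| ≤ T̄ · Σ_z M(x,z) · Σ_w |P(z,w) − P'(z,w)|. -/
/-- ℓ1 bound on the difference between resolvent rows. -/
theorem stmt_18 {X : Type*} [Fintype X] [Nonempty X] [DecidableEq X]
    (x : X) (T : ℝ) (hT : 0 ≤ T)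
    (P P' : Matrix X X ℝ) (hP : IsUnit (1 - P)) (hP' : IsUnit (1 - P'))
    (hM : ∀ a b, 0 ≤ (1 - P)⁻¹ a b) (hM' : ∀ a b, 0 ≤ (1 - P')⁻¹ a b)
    (hrow : ∀ w, ∑ y, (1 - P')⁻¹ w y ≤ T) :
    ∑ y, |(1 - P)⁻¹ x y - (1 - P')⁻¹ x y| ≤
      T * ∑ z, (1 - P)⁻¹ x z * ∑ w, |P z w - P' z w| := by
  have h1 : (1 - P)⁻¹ * (1 - P) = 1 :=
    Matrix.nonsing_inv_mul _ ((Matrix.isUnit_iff_isUnit_det _).1 hP)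
  have h2 : (1 - P') * (1 - P')⁻¹ = 1 :=
    Matrix.mul_nonsing_inv _ ((Matrix.isUnit_iff_isUnit_det _).1 hP')
  generalize (1 - P)⁻¹ = M at *
  generalize (1 - P')⁻¹ = N at *
  have key : M - N = M * (P - P') * N := by
    have e : P - P' = (1 - P') - (1 - P) := by abel
    rw [e, mul_sub, sub_mul, h1, one_mul, mul_assoc, h2, mul_one]
  have hent : ∀ y, |M x y - N x y| ≤ ∑ w, (∑ z, M x z * |P z w - P' z w|) * N w y := by
    intro y
    have : M x y - N x y = ∑ w, (∑ z, M x z * (P z w - P' z w)) * N w y := by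
      have := congrFun (congrFun key x) y
      simpa [Matrix.mul_apply] using this
    rw [this]
    refine (Finset.abs_sum_le_sum_abs _ _).trans (Finset.sum_le_sum fun w _ => ?_)
    rw [abs_mul, abs_of_nonneg (hM' w y)]
    refine mul_le_mul_of_nonneg_right ?_ (hM' w y)
    refine (Finset.abs_sum_le_sum_abs _ _).trans (Finset.sum_le_sum fun z _ => ?_)
    rw [abs_mul, abs_of_nonneg (hM x z)]
  calc ∑ y, |M x y - N x y|
      ≤ ∑ y, ∑ w, (∑ z, M x z * |P z w - P' z w|) * N w y :=
        Finset.sum_le_sum fun y _ => hent y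
    _ = ∑ w, (∑ z, M x z * |P z w - P' z w|) * ∑ y, N w y := by
        rw [Finset.sum_comm]; simp_rw [Finset.mul_sum]
    _ ≤ ∑ w, (∑ z, M x z * |P z w - P' z w|) * T :=
        Finset.sum_le_sum fun w _ => mul_le_mul_of_nonneg_left (hrow w)
          (Finset.sum_nonneg fun z _ => mul_nonneg (hM x z) (abs_nonneg _))
    _ = T * ∑ z, M x z * ∑ w, |P z w - P' z w| := by
        rw [← Finset.sum_mul, mul_comm, Finset.sum_comm]; simp_rw [Finset.mul_sum]
end

section
/- Let X and A be finite nonempty types, x₀ ∈ X, T̄ ≥ 0 a real, and P : X → A → X → ℝ a substochastic kernel (P(x'|x,a) ≥ 0, Σ_{x'} P(x'|x,a) ≤ 1). Let c : X → A → ℝ, and let π and π' be policies with transition matrices P_π(x,x') = Σ_a π(a|x) P(x'|x,a), P_{π'}(x,x') = Σ_a π'(a|x) P(x'|x,a) and cost vectors c_π(x) = Σ_a π(a|x) c(x,a), c_{π'}(x) = Σ_a π'(a|x) c(x,a). Assume I − P_π and I − P_{π'} are invertible, M := (I − P_π)⁻¹ and M' := (I − P_{π'})⁻¹ are entrywise nonnegative,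 and the row sums of M' are at most T̄. Let V_π := M c_π, let δ(x) := c_{π'}(x) + (P_{π'} V_π)(x) − V_π(x), let Λ := (M δ)(x₀), and let Δ be a real with |δ(x)| ≤ Δ for all x. Then |(M' c_{π'})(x₀) − (M c_π)(x₀) − Λ| ≤ 2 Δ T̄ · Σ_z M(x₀, z) · D_TV(π'‖π)(z), where D_TV(π'‖π)(z) = (1/2) Σ_a |π'(a|z) − π(a|z)|. Equivalently, Λ − E ≤ C_{π'}(x₀) − C_π(x₀) ≤ Λ + E, where E denotes the right-hand side. -/
/-- Lemma 2 of the paper: performance-difference error bound. -/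
theorem stmt_19 {X A : Type*} [Fintype X] [Fintype A] [Nonempty X] [Nonempty A]
    [DecidableEq X]
    (x₀ : X) (T : ℝ) (hT : 0 ≤ T)
    (P : X → A → X → ℝ) (hPnn : ∀ x a x', 0 ≤ P x a x')
    (hPsub : ∀ x a, ∑ x', P x a x' ≤ 1)
    (c : X → A → ℝ)
    (π π' : X → A → ℝ)
    (hπnn : ∀ x a, 0 ≤ π x a) (hπ1 : ∀ x, ∑ a, π x a = 1)
    (hπ'nn : ∀ x a, 0 ≤ π' x a) (hπ'1 : ∀ x, ∑ a, π' x a = 1)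
    (Pπ Pπ' : Matrix X X ℝ)
    (hPπ : Pπ = Matrix.of fun x x' => ∑ a, π x a * P x a x')
    (hPπ' : Pπ' = Matrix.of fun x x' => ∑ a, π' x a * P x a x')
    (cπ cπ' : X → ℝ)
    (hcπ : cπ = fun x => ∑ a, π x a * c x a)
    (hcπ' : cπ' = fun x => ∑ a, π' x a * c x a)
    (hInv : IsUnit (1 - Pπ)) (hInv' : IsUnit (1 - Pπ'))
    (hM : ∀ a b, 0 ≤ (1 - Pπ)⁻¹ a b) (hM' : ∀ a b, 0 ≤ (1 - Pπ')⁻¹ a b)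
    (hrow' : ∀ w, ∑ y, (1 - Pπ')⁻¹ w y ≤ T)
    (Vπ : X → ℝ) (hV : Vπ = (1 - Pπ)⁻¹.mulVec cπ)
    (δ : X → ℝ) (hδ : δ = fun x => cπ' x + Pπ'.mulVec Vπ x - Vπ x)
    (Λ : ℝ) (hΛ : Λ = (1 - Pπ)⁻¹.mulVec δ x₀)
    (Δ : ℝ) (hΔ : ∀ x, |δ x| ≤ Δ) :
    |(1 - Pπ')⁻¹.mulVec cπ' x₀ - (1 - Pπ)⁻¹.mulVec cπ x₀ - Λ| ≤
      2 * Δ * T * ∑ z, (1 - Pπ)⁻¹ x₀ z * ((1 / 2) * ∑ a, |π' z a - π z a|) := by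
  have hd := (Matrix.isUnit_iff_isUnit_det _).mp hInv
  have hd' := (Matrix.isUnit_iff_isUnit_det _).mp hInv'
  have hΔ0 : 0 ≤ Δ := (abs_nonneg _).trans (hΔ x₀)
  have hδ2 : δ = cπ' - (1 - Pπ').mulVec Vπ := by
    rw [hδ, Matrix.sub_mulVec, Matrix.one_mulVec]
    funext x
    simp only [Pi.sub_apply]
    ring
  obtain ⟨u, hu⟩ : ∃ u, u = (1 - Pπ')⁻¹.mulVec δ := ⟨_, rfl⟩
  have hu1 : u = (1 - Pπ')⁻¹.mulVec cπ' - Vπ := by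
    rw [hu, hδ2, Matrix.mulVec_sub, Matrix.mulVec_mulVec, Matrix.nonsing_inv_mul _ hd',
      Matrix.one_mulVec]
  have hu2 : (1 - Pπ').mulVec u = δ := by
    rw [hu, Matrix.mulVec_mulVec, Matrix.mul_nonsing_inv _ hd', Matrix.one_mulVec]
  have hu3 : u = (1 - Pπ)⁻¹.mulVec ((1 - Pπ).mulVec u) := by
    rw [Matrix.mulVec_mulVec, Matrix.nonsing_inv_mul _ hd, Matrix.one_mulVec]
  have key : u - (1 - Pπ)⁻¹.mulVec δ = (1 - Pπ)⁻¹.mulVec ((Pπ' - Pπ).mulVec u) := by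
    have h1 : (Pπ' - Pπ).mulVec u = (1 - Pπ).mulVec u - δ := by
      rw [← hu2, ← Matrix.sub_mulVec]
      congr 1
      abel
    rw [h1, Matrix.mulVec_sub, ← hu3]
  have hub : ∀ x, |u x| ≤ T * Δ := by
    intro x
    rw [hu]
    simp only [Matrix.mulVec, dotProduct]
    calc _ ≤ ∑ y, |(1 - Pπ')⁻¹ x y * δ y| := Finset.abs_sum_le_sum_abs _ _
      _ ≤ ∑ y, (1 - Pπ')⁻¹ x y * Δ := by
        refine Finset.sum_le_sum fun y _ => ?_
        rw [abs_mul, abs_of_nonneg (hM' x y)]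
        exact mul_le_mul_of_nonneg_left (hΔ y) (hM' x y)
      _ ≤ T * Δ := by
        rw [← Finset.sum_mul]
        exact mul_le_mul_of_nonneg_right (hrow' x) hΔ0
  have hPu : ∀ z a, |∑ y, P z a y * u y| ≤ T * Δ := by
    intro z a
    calc _ ≤ ∑ y, |P z a y * u y| := Finset.abs_sum_le_sum_abs _ _
      _ ≤ ∑ y, P z a y * (T * Δ) := by
        refine Finset.sum_le_sum fun y _ => ?_
        rw [abs_mul, abs_of_nonneg (hPnn z a y)]
        exact mul_le_mul_of_nonneg_left (hub y) (hPnn z a y)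
      _ ≤ 1 * (T * Δ) := by
        rw [← Finset.sum_mul]
        exact mul_le_mul_of_nonneg_right (hPsub z a) (mul_nonneg hT hΔ0)
      _ = T * Δ := one_mul _
  have hz : ∀ z, |(Pπ' - Pπ).mulVec u z| ≤ (∑ a, |π' z a - π z a|) * (T * Δ) := by
    intro z
    have h1 : (Pπ' - Pπ).mulVec u z = ∑ a, (π' z a - π z a) * ∑ y, P z a y * u y := by
      rw [hPπ, hPπ']
      simp only [Matrix.mulVec, dotProduct, Matrix.sub_apply, Matrix.of_apply]
      simp only [← Finset.sum_sub_distrib, Finset.sum_mul, Finset.mul_sum]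
      rw [Finset.sum_comm]
      refine Finset.sum_congr rfl fun a _ => Finset.sum_congr rfl fun y _ => ?_
      ring
    rw [h1, Finset.sum_mul]
    refine (Finset.abs_sum_le_sum_abs _ _).trans (Finset.sum_le_sum fun a _ => ?_)
    rw [abs_mul]
    exact mul_le_mul_of_nonneg_left (hPu z a) (abs_nonneg _)
  have hmain : (1 - Pπ')⁻¹.mulVec cπ' x₀ - (1 - Pπ)⁻¹.mulVec cπ x₀ - Λ
      = (1 - Pπ)⁻¹.mulVec ((Pπ' - Pπ).mulVec u) x₀ := by
    rw [← key, hΛ, ← hV, Pi.sub_apply, hu1, Pi.sub_apply]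
  rw [hmain, Matrix.mulVec, dotProduct, Finset.mul_sum]
  refine (Finset.abs_sum_le_sum_abs _ _).trans (Finset.sum_le_sum fun z _ => ?_)
  rw [abs_mul, abs_of_nonneg (hM x₀ z)]
  refine (mul_le_mul_of_nonneg_left (hz z) (hM x₀ z)).trans (le_of_eq ?_)
  ring
end
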